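/- Let r ≥ 2, let α ≥ 1 be a real number, let G be an r-graph, and let k ≥ 1 be an integer. Then the uniform blow-up G(k,…,k) satisfies λ^(α)(G(k,…,k)) = k^{r−r/α}·λ^(α)(G). -/

import Mathlib

/-!
Common definitions: `r`-uniform hypergraphs on vertex set `Fin n`, the polyform,
the parameter `λ^(α)`, degrees, properties of `r`-graphs, blow-ups, extremal
numbers and chromatic numbers.
-/

open Finset

/-- An `r`-uniform hypergraph on the vertex set `Fin n`. -/
structure HGraph (r n : ℕ) where
  edges : Finset (Finset (Fin n))
  uniform : ∀ e ∈ edges, e.card = r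

namespace HGraph

/-- The polyform `P_G(x) = r! ∑_{e ∈ E(G)} ∏_{i ∈ e} x_i`. -/
noncomputable def polyform {r n : ℕ} (G : HGraph r n) (x : Fin n → ℝ) : ℝ :=
  (r.factorial : ℝ) * ∑ e ∈ G.edges, ∏ i ∈ e, x i

/-- `λ^(α)(G)`: the maximum of the polyform over the unit sphere of `ℓ^α`. -/
noncomputable def lam {r n : ℕ} (α : ℝ) (G : HGraph r n) : ℝ :=
  sSup {y : ℝ | ∃ x : Fin n → ℝ, (∑ i, |x i| ^ α) = 1 ∧ y = G.polyform x}

/-- The degree of a vertex: the number of edges containing it. -/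
def degree {r n : ℕ} (G : HGraph r n) (v : Fin n) : ℕ :=
  (G.edges.filter (fun e => v ∈ e)).card

/-- Maximum degree `Δ(G)`. -/
def maxDeg {r n : ℕ} (G : HGraph r n) : ℕ :=
  Finset.univ.sup G.degree

/-- Minimum degree `δ(G)`. -/
noncomputable def minDeg {r n : ℕ} (G : HGraph r n) : ℕ :=
  sInf (Set.range G.degree)

/-- `G` is regular if all vertices have equal degrees. -/
def Regular {r n : ℕ} (G : HGraph r n) : Prop :=
  ∀ u v : Fin n, G.degree u = G.degree v

/-- The induced subgraph of `G` along the embedding `f`. -/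
def induce {r n m : ℕ} (G : HGraph r n) (f : Fin m ↪ Fin n) : HGraph r m where
  edges := Finset.univ.filter (fun e : Finset (Fin m) => e.map f ∈ G.edges)
  uniform := by
    intro e he
    rw [Finset.mem_filter] at he
    have h2 := G.uniform _ he.2
    rwa [Finset.card_map] at h2

/-- A property of `r`-graphs: a family closed under isomorphism (relabeling). -/
def IsProperty {r : ℕ} (P : ∀ n, Set (HGraph r n)) : Prop :=
  ∀ n : ℕ, ∀ σ : Equiv.Perm (Fin n), ∀ G ∈ P n, G.induce σ.toEmbedding ∈ P n

/-- A hereditary property: closed under taking induced subgraphs. -/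
def Hereditary {r : ℕ} (P : ∀ n, Set (HGraph r n)) : Prop :=
  ∀ n m : ℕ, ∀ f : Fin m ↪ Fin n, ∀ G ∈ P n, G.induce f ∈ P m

/-- A monotone property: closed under taking subgraphs. -/
def MonotoneProp {r : ℕ} (P : ∀ n, Set (HGraph r n)) : Prop :=
  ∀ n m : ℕ, ∀ f : Fin m ↪ Fin n, ∀ G ∈ P n, ∀ H : HGraph r m,
    (∀ e ∈ H.edges, e.map f ∈ G.edges) → H ∈ P m

/-- `B`, together with the projection `φ : V(B) → V(G)`, is (a copy of) the blow-up
`G(k 1, …, k n)` of `G`: the fiber over a vertex `i` of `G` has `k i` vertices, and the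
edges of `B` are exactly the transversals of the classes corresponding to edges of `G`. -/
def IsBlowup {r n N : ℕ} (G : HGraph r n) (k : Fin n → ℕ)
    (B : HGraph r N) (φ : Fin N → Fin n) : Prop :=
  (∀ i : Fin n, (Finset.univ.filter (fun v => φ v = i)).card = k i) ∧
  ∀ s : Finset (Fin N), s ∈ B.edges ↔ (Set.InjOn φ ↑s ∧ s.image φ ∈ G.edges)

/-- A multiplicative property: contains all blow-ups of all of its members. -/
def MultiplicativeProp {r : ℕ} (P : ∀ n, Set (HGraph r n)) : Prop :=
  ∀ n : ℕ, ∀ G ∈ P n, ∀ k : Fin n → ℕ, (∀ i, 0 < k i) →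
    ∀ N : ℕ, ∀ B : HGraph r N, ∀ φ : Fin N → Fin n, IsBlowup G k B φ → B ∈ P N

/-- The extremal number `ex(P, n)`: the maximum number of edges of a member of `P`
of order `n`. -/
noncomputable def exP {r : ℕ} (P : ∀ n, Set (HGraph r n)) (n : ℕ) : ℕ :=
  sSup {m : ℕ | ∃ G ∈ P n, G.edges.card = m}

/-- `λ^(α)(P, n)`: the maximum of `λ^(α)(G)` over members `G` of `P` of order `n`. -/
noncomputable def lamP {r : ℕ} (α : ℝ) (P : ∀ n, Set (HGraph r n)) (n : ℕ) : ℝ :=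
  sSup {y : ℝ | ∃ G ∈ P n, y = lam α G}

/-- The chromatic number: the least `k` such that the vertices can be `k`-colored
with no monochromatic edge (i.e. partitioned into `k` edgeless sets). -/
noncomputable def chrom {r n : ℕ} (G : HGraph r n) : ℕ :=
  sInf {k : ℕ | ∃ c : Fin n → Fin k, ∀ e ∈ G.edges, ¬ ∀ u ∈ e, ∀ w ∈ e, c u = c w}

/-- The weak chromatic number: the least `k` such that the vertices can be `k`-colored
with every edge getting `r` distinct colors (every class meets every edge in ≤ 1 vertex). -/
noncomputable def wchrom {r n : ℕ} (G : HGraph r n) : ℕ :=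
  sInf {k : ℕ | ∃ c : Fin n → Fin k, ∀ e ∈ G.edges, Set.InjOn c ↑e}

/-- `Mon(H)`: the (monotone, hereditary) property of all `r`-graphs containing no
subgraph isomorphic to `H`. -/
def MonP {r h : ℕ} (H : HGraph r h) : ∀ n, Set (HGraph r n) :=
  fun n => {G | ¬ ∃ f : Fin h ↪ Fin n, ∀ e ∈ H.edges, e.map f ∈ G.edges}

end HGraph

open HGraph

namespace HGraph

/-- Expanding a product of fiber sums gives the sum over all transversals of the fibers. -/
theorem prod_sum_fiber_eq_sum_transversals {ι κ R : Type*} [Fintype ι] [DecidableEq ι]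
    [DecidableEq κ] [CommSemiring R] (φ : ι → κ) (y : ι → R) (e : Finset κ)
    [DecidablePred fun s : Finset ι => Set.InjOn φ ↑s ∧ s.image φ = e] :
    ∏ i ∈ e, ∑ v with φ v = i, y v =
      ∑ s ∈ Finset.univ.filter (fun s : Finset ι => Set.InjOn φ ↑s ∧ s.image φ = e),
        ∏ v ∈ s, y v := by
  rw [Finset.prod_sum]
  have key : ∀ p ∈ e.pi (fun i => Finset.univ.filter (fun v => φ v = i)),
      ∀ i (hi : i ∈ e), φ (p i hi) = i := by
    intro p hp i hi
    simpa using Finset.mem_pi.1 hp i hi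
  refine Finset.sum_bij (fun p _ => e.attach.image (fun i => p i.1 i.2)) ?_ ?_ ?_ ?_
  · intro p hp
    have h := key p hp
    simp only [Finset.mem_filter, Finset.mem_univ, true_and]
    constructor
    · intro a ha b hb hab
      simp only [Finset.coe_image, Set.mem_image, Finset.mem_coe, Finset.mem_attach, true_and,
        Subtype.exists] at ha hb
      obtain ⟨i, hi, rfl⟩ := ha
      obtain ⟨j, hj, rfl⟩ := hb
      rw [h, h] at hab
      subst hab
      rfl
    · ext i
      simp only [Finset.mem_image, Finset.mem_attach, true_and, Subtype.exists]
      constructor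
      · rintro ⟨_, ⟨j, hj, rfl⟩, rfl⟩
        rwa [h]
      · intro hi
        exact ⟨_, ⟨i, hi, rfl⟩, h i hi⟩
  · intro p hp q hq hpq
    funext i hi
    have hmem : p i hi ∈ e.attach.image (fun i => q i.1 i.2) := by
      rw [← hpq]
      exact Finset.mem_image.2 ⟨⟨i, hi⟩, Finset.mem_attach _ _, rfl⟩
    obtain ⟨⟨j, hj⟩, -, hji⟩ := Finset.mem_image.1 hmem
    have hij : j = i := by
      rw [← key q hq j hj, ← key p hp i hi]
      exact congrArg φ hji
    subst hij
    exact hji.symm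
  · intro s hs
    simp only [Finset.mem_filter, Finset.mem_univ, true_and] at hs
    obtain ⟨hinj, rfl⟩ := hs
    choose g hg using fun i (hi : i ∈ s.image φ) => Finset.mem_image.1 hi
    refine ⟨g, ?_, ?_⟩
    · exact Finset.mem_pi.2 fun i hi => by simpa using (hg i hi).2
    · ext v
      simp only [Finset.mem_image, Finset.mem_attach, true_and, Subtype.exists]
      constructor
      · rintro ⟨i, hi, rfl⟩
        exact (hg i _).1
      · intro hv
        have hφv := hg (φ v) (Finset.mem_image_of_mem φ hv)
        exact ⟨φ v, ⟨v, hv, rfl⟩, hinj hφv.1 hv hφv.2⟩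
  · intro p hp
    rw [Finset.prod_image]
    rintro ⟨i, hi⟩ - ⟨j, hj⟩ - hij
    have := congrArg φ hij
    simpa [key p hp] using this

theorem IsBlowup.polyform_eq {r n N : ℕ} {G : HGraph r n} {k : Fin n → ℕ} {B : HGraph r N}
    {φ : Fin N → Fin n} (hB : IsBlowup G k B φ) (y : Fin N → ℝ) :
    B.polyform y = G.polyform fun i => ∑ v with φ v = i, y v := by
  classical
  unfold polyform
  congr 1
  rw [← Finset.sum_fiberwise_of_maps_to (fun s hs => ((hB.2 s).1 hs).2)]
  refine Finset.sum_congr rfl fun e he => ?_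
  rw [prod_sum_fiber_eq_sum_transversals]
  refine Finset.sum_congr ?_ fun _ _ => rfl
  ext s
  simp only [Finset.mem_filter, hB.2 s, Finset.mem_univ, true_and]
  constructor
  · rintro ⟨⟨h, -⟩, h'⟩
    exact ⟨h, h'⟩
  · rintro ⟨h, rfl⟩
    exact ⟨⟨h, he⟩, rfl⟩

theorem polyform_const_mul {r n : ℕ} (G : HGraph r n) (c : ℝ) (x : Fin n → ℝ) :
    (G.polyform fun i => c * x i) = c ^ r * G.polyform x := by
  unfold polyform
  rw [mul_left_comm, Finset.mul_sum G.edges _ (c ^ r)]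
  congr 1
  refine Finset.sum_congr rfl fun e he => ?_
  rw [Finset.prod_mul_distrib, Finset.prod_const, G.uniform e he]

theorem bddAbove_polyform_sphere {r n : ℕ} {α : ℝ} (hα : 0 < α) (G : HGraph r n) :
    BddAbove {y : ℝ | ∃ x : Fin n → ℝ, (∑ i, |x i| ^ α) = 1 ∧ y = G.polyform x} := by
  refine ⟨r.factorial * ∑ e ∈ G.edges, 1, ?_⟩
  rintro _ ⟨x, hx, rfl⟩
  have hx1 : ∀ i, |x i| ≤ 1 := by
    intro i
    have h : |x i| ^ α ≤ 1 := by
      rw [← hx]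
      exact Finset.single_le_sum (f := fun i => |x i| ^ α)
        (fun j _ => Real.rpow_nonneg (abs_nonneg _) _) (Finset.mem_univ i)
    exact (Real.rpow_le_rpow_iff (abs_nonneg _) zero_le_one hα).1 (by rwa [Real.one_rpow])
  unfold polyform
  gcongr with e he
  refine (le_abs_self _).trans ?_
  rw [Finset.abs_prod]
  exact Finset.prod_le_one (fun _ _ => abs_nonneg _) fun i _ => hx1 i

theorem polyform_le_lam {r n : ℕ} {α : ℝ} (hα : 0 < α) (G : HGraph r n) {x : Fin n → ℝ}
    (hx : ∑ i, |x i| ^ α = 1) : G.polyform x ≤ lam α G :=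
  le_csSup (bddAbove_polyform_sphere hα G) ⟨x, hx, rfl⟩

theorem lam_nonneg {r n : ℕ} {α : ℝ} (hα : 0 < α) (G : HGraph r n) : 0 ≤ lam α G := by
  rcases n.eq_zero_or_pos with rfl | hn
  · simp [lam]
  · have hx : ∑ i : Fin n, |(Pi.single ⟨0, hn⟩ 1 : Fin n → ℝ) i| ^ α = 1 := by
      rw [Finset.sum_eq_single ⟨0, hn⟩]
      · simp
      · intro i _ hi
        simp [hi, hα.ne']
      · simp
    refine le_trans ?_ (polyform_le_lam hα G hx)
    unfold polyform
    have : (0 : Fin n → ℝ) ≤ Pi.single ⟨0, hn⟩ 1 := Pi.single_nonneg.2 zero_le_one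
    exact mul_nonneg (Nat.cast_nonneg _)
      (Finset.sum_nonneg fun e _ => Finset.prod_nonneg fun i _ => this i)

theorem polyform_le_lam_of_sum_le_one {r n : ℕ} (hr : r ≠ 0) {α : ℝ} (hα : 0 < α)
    (G : HGraph r n) {x : Fin n → ℝ} (hx : ∑ i, |x i| ^ α ≤ 1) : G.polyform x ≤ lam α G := by
  have hnn : ∀ i ∈ Finset.univ, 0 ≤ |x i| ^ α := fun i _ => Real.rpow_nonneg (abs_nonneg _) _
  rcases (Finset.sum_nonneg hnn).eq_or_lt with h0 | hpos
  · have hx0 : x = fun i => 0 * x i := by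
      funext i
      have := (Finset.sum_eq_zero_iff_of_nonneg hnn).1 h0.symm i (Finset.mem_univ i)
      rw [Real.rpow_eq_zero (abs_nonneg _) hα.ne', abs_eq_zero] at this
      simp [this]
    rw [hx0, polyform_const_mul, zero_pow hr, zero_mul]
    exact lam_nonneg hα G
  · set t := ∑ i, |x i| ^ α with ht
    set s := t ^ α⁻¹ with hs
    have hs0 : 0 < s := Real.rpow_pos_of_pos hpos _
    have hs1 : s ≤ 1 := Real.rpow_le_one hpos.le hx (inv_nonneg.2 hα.le)
    have hsα : s ^ α = t := Real.rpow_inv_rpow hpos.le hα.ne'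
    have hunit : ∑ i, |s⁻¹ * x i| ^ α = 1 := by
      simp_rw [abs_mul, Real.mul_rpow (abs_nonneg _) (abs_nonneg _), ← Finset.mul_sum, ← ht]
      rw [abs_of_pos (inv_pos.2 hs0), Real.inv_rpow hs0.le, hsα, inv_mul_cancel₀ hpos.ne']
    have hxs : x = fun i => s * (s⁻¹ * x i) := by
      funext i
      rw [mul_inv_cancel_left₀ hs0.ne']
    rw [hxs, polyform_const_mul]
    calc s ^ r * G.polyform (fun i => s⁻¹ * x i) ≤ s ^ r * lam α G := by
          gcongr
          exact polyform_le_lam hα G hunit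
      _ ≤ lam α G := mul_le_of_le_one_left (lam_nonneg hα G) (pow_le_one₀ hs0.le hs1)

end HGraph

/-- Proposition 8: for `α ≥ 1`, an `r`-graph `G` and an integer
`k ≥ 1`, the uniform blow-up `G(k, …, k)` satisfies
`λ^(α)(G(k,…,k)) = k^{r−r/α}·λ^(α)(G)`. -/
theorem stmt6 {r n N : ℕ} (hr : 2 ≤ r) (α : ℝ) (hα : 1 ≤ α) (G : HGraph r n)
    (k : ℕ) (hk : 1 ≤ k) (B : HGraph r N) (φ : Fin N → Fin n)
    (hB : IsBlowup G (fun _ => k) B φ) :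
    lam α B = (k : ℝ) ^ ((r : ℝ) - (r : ℝ) / α) * lam α G := by
  have hα0 : 0 < α := zero_lt_one.trans_le hα
  have hk0 : (0 : ℝ) < k := by exact_mod_cast hk
  set c : ℝ := (k : ℝ) ^ (1 - α⁻¹) with hc
  have hc0 : 0 < c := Real.rpow_pos_of_pos hk0 _
  have hcr : (k : ℝ) ^ ((r : ℝ) - (r : ℝ) / α) = c ^ r := by
    rw [hc, ← Real.rpow_natCast, ← Real.rpow_mul hk0.le]
    congr 1
    field_simp
  have hcα : c ^ α = (k : ℝ) ^ (α - 1) := by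
    rw [hc, ← Real.rpow_mul hk0.le]
    congr 1
    field_simp
  have hfib : ∀ i, (Finset.univ.filter (fun v => φ v = i)).card = k := hB.1
  rw [hcr]
  apply le_antisymm
  · refine Real.sSup_le ?_ (mul_nonneg (pow_nonneg hc0.le _) (lam_nonneg hα0 G))
    rintro _ ⟨y, hy, rfl⟩
    have hY : (fun i => ∑ v with φ v = i, y v) =
        fun i => c * (c⁻¹ * ∑ v with φ v = i, y v) := by
      funext i
      rw [mul_inv_cancel_left₀ hc0.ne']
    rw [hB.polyform_eq, hY, polyform_const_mul]
    gcongr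
    apply polyform_le_lam_of_sum_le_one (by omega) hα0
    have hmean : ∀ i, |c⁻¹ * ∑ v with φ v = i, y v| ^ α ≤ ∑ v with φ v = i, |y v| ^ α := by
      intro i
      rw [abs_mul, Real.mul_rpow (abs_nonneg _) (abs_nonneg _), abs_of_pos (inv_pos.2 hc0),
        Real.inv_rpow hc0.le, inv_mul_le_iff₀ (Real.rpow_pos_of_pos hc0 _), hcα]
      calc |∑ v with φ v = i, y v| ^ α ≤ (∑ v with φ v = i, |y v|) ^ α := by
            gcongr
            exact Finset.abs_sum_le_sum_abs _ _
        _ ≤ _ := by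
            have := Real.rpow_sum_le_const_mul_sum_rpow
              (Finset.univ.filter (fun v => φ v = i)) y hα
            rwa [hfib] at this
    calc _ ≤ ∑ i, ∑ v with φ v = i, |y v| ^ α := Finset.sum_le_sum fun i _ => hmean i
      _ = ∑ v, |y v| ^ α := Finset.sum_fiberwise _ _ _
      _ = 1 := hy
  · rw [mul_comm, ← le_div_iff₀ (pow_pos hc0 _)]
    refine Real.sSup_le ?_ (div_nonneg (lam_nonneg hα0 B) (pow_nonneg hc0.le _))
    rintro _ ⟨x, hx, rfl⟩
    rw [le_div_iff₀ (pow_pos hc0 _), mul_comm, ← polyform_const_mul]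
    have hd0 : (0 : ℝ) < (k : ℝ) ^ (-α⁻¹) := Real.rpow_pos_of_pos hk0 _
    have hlift : (fun i => c * x i) =
        fun i => ∑ v with φ v = i, (k : ℝ) ^ (-α⁻¹) * x (φ v) := by
      funext i
      rw [Finset.sum_congr rfl (g := fun _ => (k : ℝ) ^ (-α⁻¹) * x i)
        fun v hv => by rw [(Finset.mem_filter.1 hv).2], Finset.sum_const, hfib, nsmul_eq_mul,
        ← mul_assoc, hc, sub_eq_add_neg, Real.rpow_add hk0, Real.rpow_one]
    rw [hlift, ← hB.polyform_eq fun v => (k : ℝ) ^ (-α⁻¹) * x (φ v)]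
    apply polyform_le_lam hα0
    have hdα : ((k : ℝ) ^ (-α⁻¹)) ^ α = (k : ℝ)⁻¹ := by
      rw [← Real.rpow_mul hk0.le, neg_mul, inv_mul_cancel₀ hα0.ne', Real.rpow_neg_one]
    simp_rw [abs_mul, Real.mul_rpow (abs_nonneg _) (abs_nonneg _), abs_of_pos hd0, hdα]
    rw [← Finset.sum_fiberwise _ φ, ← hx]
    refine Finset.sum_congr rfl fun i _ => ?_
    rw [Finset.sum_congr rfl (g := fun _ => (k : ℝ)⁻¹ * |x i| ^ α)
      fun v hv => by rw [(Finset.mem_filter.1 hv).2], Finset.sum_const, hfib, nsmul_eq_mul,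
      mul_inv_cancel_left₀ hk0.ne']
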